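/- Let p be a real number with 0 < p ≤ 1 and let (aₙ)_{n≥2} be a sequence of nonnegative real numbers such that a₂ ≤ p and, for every integer n ≥ 3, aₙ ≤ 2np·(a_{n−1} − aₙ) − p·aₙ. Then for every integer n ≥ 2, aₙ ≤ p · ∏_{k=3}^{n} (2kp)/(2kp + p + 1) (the product being empty, hence 1, when n = 2). -/

import Mathlib

/-- Let `p` be a real number with `0 < p ≤ 1` and `(aₙ)_{n ≥ 2}` a sequence of
nonnegative reals with `a₂ ≤ p` and, for every `n ≥ 3`,
`aₙ ≤ 2np·(a_{n−1} − aₙ) − p·aₙ`.  Then for every `n ≥ 2`,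
`aₙ ≤ p · ∏_{k=3}^{n} (2kp)/(2kp + p + 1)`. -/
theorem recursive_component_size_bound (p : ℝ) (hp0 : 0 < p) (hp1 : p ≤ 1)
    (a : ℕ → ℝ) (hnonneg : ∀ n, 2 ≤ n → 0 ≤ a n) (ha2 : a 2 ≤ p)
    (hrec : ∀ n, 3 ≤ n → a n ≤ 2 * n * p * (a (n - 1) - a n) - p * a n) :
    ∀ n, 2 ≤ n → a n ≤ p * ∏ k ∈ Finset.Icc 3 n, (2 * k * p) / (2 * k * p + p + 1) := by
  intro n hn
  induction n, hn using Nat.le_induction with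
  | base => simpa using ha2
  | succ n hn ih =>
    have hstep := hrec (n + 1) (by omega)
    rw [Nat.add_sub_cancel] at hstep
    rw [Finset.prod_Icc_succ_top (by omega), ← mul_assoc]
    have hden : 0 < 2 * ((n + 1 : ℕ) : ℝ) * p + p + 1 := by positivity
    have hratio : 0 ≤ (2 * ((n + 1 : ℕ) : ℝ) * p) / (2 * ((n + 1 : ℕ) : ℝ) * p + p + 1) := by
      positivity
    refine le_trans ?_ (mul_le_mul_of_nonneg_right ih hratio)
    rw [← mul_div_assoc, le_div_iff₀ hden]
    linarith
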